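/- Consider two Kuramoto oscillators coupled as in the network model: θᵢ'(t) = ωᵢ + a·sin(θⱼ(t) − θᵢ(t)) and θⱼ'(t) = ωⱼ + a·sin(θᵢ(t) − θⱼ(t)) with coupling strength a ≥ 0. Then every solution satisfies |θᵢ'(t) − θⱼ'(t)| → 0 as t → ∞ if and only if |ωᵢ − ωⱼ|/2 ≤ a. -/

import Mathlib

open Real Filter

/-- A differentiable function that converges at infinity and whose derivative converges
has derivative tending to zero. -/
theorem eq_zero_of_tendsto_of_tendsto_hasDerivAt {φ φ' : ℝ → ℝ} {L m : ℝ}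
    (hφ : ∀ t ≥ (0 : ℝ), HasDerivAt φ (φ' t) t)
    (hL : Tendsto φ atTop (nhds L)) (hm : Tendsto φ' atTop (nhds m)) : m = 0 := by
  have hmvt : ∀ n : ℕ, ∃ c ∈ Set.Ioo (n : ℝ) (n + 1), φ' c = φ (n + 1) - φ n := by
    intro n
    have hn : (0 : ℝ) ≤ n := n.cast_nonneg
    obtain ⟨c, hc, h⟩ := exists_hasDerivAt_eq_slope φ φ' (lt_add_one (n : ℝ))
      (fun x hx => (hφ x (hn.trans hx.1)).continuousAt.continuousWithinAt)
      (fun x hx => hφ x (hn.trans hx.1.le))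
    exact ⟨c, hc, by simpa using h⟩
  choose c hc hφc using hmvt
  have hnat : Tendsto (fun n : ℕ => (n : ℝ)) atTop atTop := tendsto_natCast_atTop_atTop
  have hcTop : Tendsto c atTop atTop := tendsto_atTop_mono (fun n => (hc n).1.le) hnat
  have hdiff : Tendsto (fun n : ℕ => φ (n + 1) - φ n) atTop (nhds (L - L)) :=
    (hL.comp (tendsto_atTop_add_const_right _ 1 hnat)).sub (hL.comp hnat)
  rw [sub_self] at hdiff
  exact tendsto_nhds_unique (hm.comp hcTop) (hdiff.congr fun n => (hφc n).symm)

/-- A solution of a scalar autonomous equation whose velocity is always positive, and which has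
an equilibrium above its initial value, has velocity tending to zero. -/
theorem tendsto_velocity_zero_of_pos {f φ : ℝ → ℝ} (hf : Continuous f)
    (hφ : ∀ t ≥ (0 : ℝ), HasDerivAt φ (f (φ t)) t) (hpos : ∀ t ≥ (0 : ℝ), 0 < f (φ t))
    {e : ℝ} (he : φ 0 ≤ e) (hfe : f e = 0) :
    Tendsto (fun t => f (φ t)) atTop (nhds 0) := by
  have hcont : ContinuousOn φ (Set.Ici 0) :=
    fun t ht => (hφ t ht).continuousAt.continuousWithinAt
  have hmono : MonotoneOn φ (Set.Ici 0) := by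
    refine monotoneOn_of_deriv_nonneg (convex_Ici 0) hcont ?_ ?_ <;>
      · intro t ht
        rw [interior_Ici] at ht
        have h := hφ t (le_of_lt ht)
        first
        | exact h.differentiableAt.differentiableWithinAt
        | exact h.deriv.symm ▸ (hpos t (le_of_lt ht)).le
  have hbound : ∀ t ≥ (0 : ℝ), φ t ≤ e := by
    intro t ht
    by_contra! h
    obtain ⟨s, hs, hse⟩ := intermediate_value_Icc ht
      (hcont.mono Set.Icc_subset_Ici_self) ⟨he, h.le⟩
    have := hpos s hs.1
    rw [hse, hfe] at this
    exact this.false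
  have hconv : ∃ L, Tendsto φ atTop (nhds L) := by
    have hmono' : Monotone fun t => φ (max t 0) := fun s t hst =>
      hmono (le_max_right s 0) (le_max_right t 0) (max_le_max_right 0 hst)
    refine ⟨_, (tendsto_atTop_ciSup hmono' ⟨e, ?_⟩).congr' ?_⟩
    · rintro _ ⟨t, rfl⟩
      exact hbound _ (le_max_right t 0)
    · filter_upwards [eventually_ge_atTop 0] with t ht
      rw [max_eq_left ht]
  obtain ⟨L, hL⟩ := hconv
  have hfL : Tendsto (fun t => f (φ t)) atTop (nhds (f L)) := (hf.tendsto L).comp hL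
  rwa [eq_zero_of_tendsto_of_tendsto_hasDerivAt hφ hL hfL] at hfL

/-- Solutions of a scalar autonomous Lipschitz equation with equilibria on both sides of the
initial value have velocity tending to zero. -/
theorem tendsto_velocity_zero {f φ : ℝ → ℝ} {K : NNReal} (hf : LipschitzWith K f)
    (hφ : ∀ t ≥ (0 : ℝ), HasDerivAt φ (f (φ t)) t)
    {e₁ e₂ : ℝ} (he₁ : e₁ ≤ φ 0) (hfe₁ : f e₁ = 0) (he₂ : φ 0 ≤ e₂) (hfe₂ : f e₂ = 0) :
    Tendsto (fun t => f (φ t)) atTop (nhds 0) := by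
  have hcont : ContinuousOn φ (Set.Ici 0) :=
    fun t ht => (hφ t ht).continuousAt.continuousWithinAt
  have hfcont : ContinuousOn (fun t => f (φ t)) (Set.Ici 0) :=
    hf.continuous.comp_continuousOn hcont
  by_cases hzero : ∃ t₀ ≥ (0 : ℝ), f (φ t₀) = 0
  · obtain ⟨t₀, ht₀, hz⟩ := hzero
    refine tendsto_const_nhds.congr' ?_
    filter_upwards [eventually_ge_atTop t₀] with t ht
    have heq : Set.EqOn φ (fun _ => φ t₀) (Set.Icc t₀ t) := by
      refine ODE_solution_unique (v := fun _ => f) (K := K) (fun _ => hf)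
        (hcont.mono fun s hs => ht₀.trans hs.1)
        (fun s hs => (hφ s (ht₀.trans hs.1)).hasDerivWithinAt) continuousOn_const
        (fun s _ => ?_) rfl
      rw [hz]
      exact hasDerivWithinAt_const _ _ _
    rw [heq ⟨ht, le_rfl⟩, hz]
  · push Not at hzero
    rcases (hzero 0 le_rfl).lt_or_gt with hneg | hpos
    · have hneg' : ∀ t ≥ (0 : ℝ), f (φ t) < 0 := by
        intro t ht
        by_contra! h
        obtain ⟨s, hs, hs0⟩ := intermediate_value_Icc ht
          (hfcont.mono Set.Icc_subset_Ici_self) ⟨hneg.le, h⟩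
        exact hzero s hs.1 hs0
      have h := tendsto_velocity_zero_of_pos (f := fun x => -f (-x)) (φ := fun t => -φ t)
        (e := -e₁) (hf.continuous.comp continuous_neg).neg
        (fun t ht => by simpa using (hφ t ht).fun_neg)
        (fun t ht => by simpa using hneg' t ht) (neg_le_neg he₁) (by simpa using hfe₁)
      simpa using h.neg
    · refine tendsto_velocity_zero_of_pos hf.continuous hφ (fun t ht => ?_) he₂ hfe₂
      by_contra! h
      obtain ⟨s, hs, hs0⟩ := intermediate_value_Icc' ht
        (hfcont.mono Set.Icc_subset_Ici_self) ⟨h, hpos.le⟩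
      exact hzero s hs.1 hs0

/-- If `|ω| ≤ b`, then `ω - b * sin x` has zeros on both sides of every point. -/
theorem exists_zeros_sub_mul_sin {ω b : ℝ} (h : |ω| ≤ b) (x : ℝ) :
    ∃ e₁ ≤ x, ∃ e₂ ≥ x, ω - b * Real.sin e₁ = 0 ∧ ω - b * Real.sin e₂ = 0 := by
  have hb : b * Real.sin (Real.arcsin (ω / b)) = ω := by
    rcases ((abs_nonneg ω).trans h).eq_or_lt with hb | hb
    · rw [← hb] at h ⊢
      simp [abs_nonpos_iff.mp h]
    · rw [abs_le] at h
      rw [Real.sin_arcsin (by rw [le_div_iff₀ hb]; linarith) (by rw [div_le_one hb]; exact h.2)]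
      field_simp
  set s := Real.arcsin (ω / b)
  have hp := Real.two_pi_pos
  obtain ⟨n, hn⟩ := exists_nat_ge (|x - s| / (2 * π))
  rw [div_le_iff₀ hp, abs_le] at hn
  refine ⟨s - n * (2 * π), by linarith, s + n * (2 * π), by linarith, ?_, ?_⟩
  · rw [Real.sin_sub_nat_mul_two_pi, hb, sub_self]
  · rw [Real.sin_add_nat_mul_two_pi, hb, sub_self]

/-- The map `x ↦ ω - b * sin x` is Lipschitz. -/
theorem lipschitzWith_sub_mul_sin (ω b : ℝ) :
    LipschitzWith ‖b‖₊ fun x => ω - b * Real.sin x := by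
  refine LipschitzWith.of_dist_le_mul fun x y => ?_
  rw [Real.dist_eq, Real.dist_eq, coe_nnnorm, Real.norm_eq_abs,
    show ω - b * Real.sin x - (ω - b * Real.sin y) = -(b * (Real.sin x - Real.sin y)) by ring,
    abs_neg, abs_mul]
  exact mul_le_mul_of_nonneg_left (Real.abs_sin_sub_sin_le x y) (abs_nonneg b)

/-- **Pairwise synchronization criterion in the network-form Kuramoto model.**
Two oscillators coupled as `θᵢ' = ωᵢ + a·sin(θⱼ − θᵢ)`,
`θⱼ' = ωⱼ + a·sin(θᵢ − θⱼ)` with coupling strength `a ≥ 0` satisfy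
`|θᵢ'(t) − θⱼ'(t)| → 0` as `t → ∞` if and only if `|ωᵢ − ωⱼ|/2 ≤ a`. -/
theorem kuramoto_pair_network_sync_iff (ωi ωj a : ℝ) (ha : 0 ≤ a)
    (θi θj : ℝ → ℝ) (hθi : Differentiable ℝ θi) (hθj : Differentiable ℝ θj)
    (hodei : ∀ t ≥ (0 : ℝ), deriv θi t = ωi + a * Real.sin (θj t - θi t))
    (hodej : ∀ t ≥ (0 : ℝ), deriv θj t = ωj + a * Real.sin (θi t - θj t)) :
    Tendsto (fun t => |deriv θi t - deriv θj t|) atTop (nhds 0) ↔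
      |ωi - ωj| / 2 ≤ a := by
  have hvel : ∀ t ≥ (0 : ℝ), deriv θi t - deriv θj t =
      (ωi - ωj) - 2 * a * Real.sin (θi t - θj t) := by
    intro t ht
    rw [hodei t ht, hodej t ht, ← neg_sub (θi t) (θj t), Real.sin_neg]
    ring
  constructor
  · intro h
    have hge : |ωi - ωj| - 2 * a ≤ 0 := by
      refine ge_of_tendsto h ?_
      filter_upwards [eventually_ge_atTop 0] with t ht
      rw [hvel t ht]
      have hsin : |2 * a * Real.sin (θi t - θj t)| ≤ 2 * a := by
        rw [abs_mul, abs_of_nonneg (by linarith : 0 ≤ 2 * a)]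
        exact mul_le_of_le_one_right (by linarith) (Real.abs_sin_le_one _)
      linarith [abs_sub_abs_le_abs_sub (ωi - ωj) (2 * a * Real.sin (θi t - θj t))]
    linarith
  · intro h
    obtain ⟨e₁, he₁, e₂, he₂, hz₁, hz₂⟩ :=
      exists_zeros_sub_mul_sin (by linarith : |ωi - ωj| ≤ 2 * a) (θi 0 - θj 0)
    have hlim := tendsto_velocity_zero (φ := fun t => θi t - θj t)
      (lipschitzWith_sub_mul_sin (ωi - ωj) (2 * a))
      (fun t ht => by
        rw [← hvel t ht]
        exact (hθi t).hasDerivAt.fun_sub (hθj t).hasDerivAt)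
      he₁ hz₁ he₂ hz₂
    rw [← abs_zero]
    refine hlim.abs.congr' ?_
    filter_upwards [eventually_ge_atTop 0] with t ht
    rw [hvel t ht]
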